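/- Let n ≥ 1, let r : ℤ_{≥1} → [0,1] be a nonincreasing function with r(1) = 1, define λ_i(n) := −Σ_{k=1}^∞ r(k)·( log(1 − 1/(k+n)) + 1/(k+n−i) ) for 1 ≤ i ≤ n, and define c(n) := Σ_{k=1}^∞ r(k)/(k+n−1)². Then for every 1 ≤ i ≤ n: (a) λ_i(n) − λ_1(n) = Σ_{k=1}^∞ r(k)·( 1/(k+n−1) − 1/(k+n−i) ); (b) λ_i(n) − λ_1(n) = −(i−1)·c(n) + ε_i(n), where ε_i(n) := −(i−1)² · Σ_{k=1}^∞ r(k)/( (k+n−1)² (k+n−i) ); and (c) |ε_i(n)| ≤ ( (i−1)² / (n−i+1) ) · c(n). -/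

import Mathlib

open MeasureTheory ProbabilityTheory Matrix Filter

noncomputable section

/-- The Lyapunov exponent `λ_i(n) = -∑_{k≥1} r(k) (log(1 - 1/(k+n)) + 1/(k+n-i))`,
for a tail-frequency function `r` (indexed so that the sum below is over `k = 1, 2, …`). -/
def lam (r : ℕ → ℝ) (n i : ℕ) : ℝ :=
  -∑' k : ℕ, r (k + 1) *
    (Real.log (1 - 1 / ((k : ℝ) + 1 + n)) + 1 / ((k : ℝ) + 1 + n - i))

/-- The constant `c(n) = ∑_{k≥1} r(k)/(k+n-1)²`. -/
def cn (r : ℕ → ℝ) (n : ℕ) : ℝ := ∑' k : ℕ, r (k + 1) / ((k : ℝ) + n) ^ 2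

theorem summable_one_div_natCast_add_one_sq : Summable fun k : ℕ => 1 / ((k : ℝ) + 1) ^ 2 := by
  simpa using (summable_nat_add_iff 1).2 (Real.summable_one_div_nat_pow.2 one_lt_two)

theorem summable_mul_of_le_div_sq {s f : ℕ → ℝ} (C : ℝ) (hs : ∀ k, s k ∈ Set.Icc (0 : ℝ) 1)
    (hf0 : ∀ k, 0 ≤ f k) (hf : ∀ k, f k ≤ C * (1 / ((k : ℝ) + 1) ^ 2)) :
    Summable fun k => s k * f k :=
  .of_nonneg_of_le (fun k => mul_nonneg (hs k).1 (hf0 k))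
    (fun k => (mul_le_of_le_one_left (hf0 k) (hs k).2).trans (hf k))
    (summable_one_div_natCast_add_one_sq.mul_left C)

theorem one_div_sub_le_log_one_sub_add {y j : ℝ} (hy : 1 < y) :
    1 / (y - j) - 1 / (y - 1) ≤ Real.log (1 - 1 / y) + 1 / (y - j) := by
  have h1 : 0 < y - 1 := by linarith
  have hx : 1 - 1 / y = (y - 1) / y := by field_simp
  have h := Real.one_sub_inv_le_log_of_pos (x := 1 - 1 / y) (by rw [hx]; positivity)
  have e : 1 - (1 - 1 / y)⁻¹ = -(1 / (y - 1)) := by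
    rw [hx, inv_div]
    field_simp
    ring
  linarith

theorem log_one_sub_add_le_one_div_sub {y j : ℝ} (hy : 1 < y) :
    Real.log (1 - 1 / y) + 1 / (y - j) ≤ 1 / (y - j) - 1 / y := by
  have h1 : 0 < y - 1 := by linarith
  have hx : 1 - 1 / y = (y - 1) / y := by field_simp
  have h := Real.log_le_sub_one_of_pos (x := 1 - 1 / y) (by rw [hx]; positivity)
  linarith

theorem summable_lam {r : ℕ → ℝ} (hr : ∀ k, r (k + 1) ∈ Set.Icc (0 : ℝ) 1) {n j : ℕ}
    (hj1 : 1 ≤ j) (hjn : j ≤ n) :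
    Summable fun k : ℕ => r (k + 1) *
      (Real.log (1 - 1 / ((k : ℝ) + 1 + n)) + 1 / ((k : ℝ) + 1 + n - j)) := by
  have hj1' : (1 : ℝ) ≤ j := by exact_mod_cast hj1
  have hjn' : (j : ℝ) ≤ n := by exact_mod_cast hjn
  refine summable_mul_of_le_div_sq (j : ℝ) hr (fun k => ?_) fun k => ?_
  all_goals
    have hk : (0 : ℝ) ≤ k := k.cast_nonneg
    have hy : 1 < (k : ℝ) + 1 + n := by linarith
    have hz : 0 < (k : ℝ) + 1 + n - j := by linarith
  · refine le_trans ?_ (one_div_sub_le_log_one_sub_add hy)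
    exact sub_nonneg.2 (one_div_le_one_div_of_le hz (by linarith))
  · refine (log_one_sub_add_le_one_div_sub hy).trans ?_
    have e : 1 / ((k : ℝ) + 1 + n - j) - 1 / ((k : ℝ) + 1 + n)
        = j * (1 / (((k : ℝ) + 1 + n - j) * ((k : ℝ) + 1 + n))) := by
      field_simp
      ring
    rw [e, sq]
    gcongr <;> linarith

/-- Exact decomposition of `λ_i(n) - λ_1(n)` and error bound. -/
theorem lyapunov_difference_decomposition
    (n : ℕ) (hn : 1 ≤ n)
    (r : ℕ → ℝ)
    (hr01 : ∀ k : ℕ, 1 ≤ k → r k ∈ Set.Icc (0 : ℝ) 1)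
    (hrmono : ∀ k j : ℕ, 1 ≤ k → k ≤ j → r j ≤ r k)
    (hr1 : r 1 = 1)
    (i : ℕ) (hi1 : 1 ≤ i) (hin : i ≤ n) :
    lam r n i - lam r n 1
        = ∑' k : ℕ, r (k + 1) * (1 / ((k : ℝ) + n) - 1 / ((k : ℝ) + 1 + n - i)) ∧
    lam r n i - lam r n 1
        = -((i : ℝ) - 1) * cn r n +
          (-((i : ℝ) - 1) ^ 2 *
            ∑' k : ℕ, r (k + 1) / (((k : ℝ) + n) ^ 2 * ((k : ℝ) + 1 + n - i))) ∧
    |(-((i : ℝ) - 1) ^ 2 *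
        ∑' k : ℕ, r (k + 1) / (((k : ℝ) + n) ^ 2 * ((k : ℝ) + 1 + n - i)))|
      ≤ ((i : ℝ) - 1) ^ 2 / ((n : ℝ) - i + 1) * cn r n := by
  have hr : ∀ k, r (k + 1) ∈ Set.Icc (0 : ℝ) 1 := fun k => hr01 (k + 1) (by omega)
  have hn' : (1 : ℝ) ≤ n := by exact_mod_cast hn
  have hi1' : (1 : ℝ) ≤ i := by exact_mod_cast hi1
  have hin' : (i : ℝ) ≤ n := by exact_mod_cast hin
  have hx : ∀ k : ℕ, (k : ℝ) + 1 ≤ (k : ℝ) + n := fun k => by linarith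
  have hk : ∀ k : ℕ, (0 : ℝ) < (k : ℝ) + 1 := fun k => by positivity
  have hx0 : ∀ k : ℕ, 0 < (k : ℝ) + n := fun k => (hk k).trans_le (hx k)
  have hz : ∀ k : ℕ, 1 ≤ (k : ℝ) + 1 + n - i := fun k => by
    linarith [(k.cast_nonneg : (0 : ℝ) ≤ k)]
  have hz0 : ∀ k : ℕ, 0 < (k : ℝ) + 1 + n - i := fun k => one_pos.trans_le (hz k)
  have hc : Summable fun k : ℕ => r (k + 1) / ((k : ℝ) + n) ^ 2 := by
    simp only [div_eq_mul_one_div (r _)]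
    refine summable_mul_of_le_div_sq 1 hr (fun k => by positivity) fun k => ?_
    rw [one_mul]
    exact one_div_le_one_div_of_le (pow_pos (hk k) 2) (pow_le_pow_left₀ (hk k).le (hx k) 2)
  have hterm0 : ∀ k : ℕ, 0 ≤ r (k + 1) / (((k : ℝ) + n) ^ 2 * ((k : ℝ) + 1 + n - i)) :=
    fun k => div_nonneg (hr k).1 (mul_nonneg (sq_nonneg _) (hz0 k).le)
  have hle : ∀ k : ℕ, r (k + 1) / (((k : ℝ) + n) ^ 2 * ((k : ℝ) + 1 + n - i))
      ≤ 1 / ((n : ℝ) - i + 1) * (r (k + 1) / ((k : ℝ) + n) ^ 2) := fun k => by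
    have hd : 0 < (n : ℝ) - i + 1 := by linarith
    rw [← div_div, div_eq_mul_one_div, mul_comm]
    refine mul_le_mul_of_nonneg_right (one_div_le_one_div_of_le hd ?_)
      (div_nonneg (hr k).1 (sq_nonneg _))
    linarith [(k.cast_nonneg : (0 : ℝ) ≤ k)]
  have he : Summable fun k : ℕ => r (k + 1) / (((k : ℝ) + n) ^ 2 * ((k : ℝ) + 1 + n - i)) :=
    .of_nonneg_of_le hterm0 hle (hc.mul_left _)
  have hdiff : lam r n i - lam r n 1
      = ∑' k : ℕ, r (k + 1) * (1 / ((k : ℝ) + n) - 1 / ((k : ℝ) + 1 + n - i)) := by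
    rw [lam, lam, neg_sub_neg, ← (summable_lam hr le_rfl hn).tsum_sub (summable_lam hr hi1 hin)]
    refine tsum_congr fun k => ?_
    rw [show (k : ℝ) + 1 + n - (1 : ℕ) = k + n by push_cast; ring]
    ring
  refine ⟨hdiff, ?_, ?_⟩
  · rw [hdiff, cn, ← tsum_mul_left, ← tsum_mul_left, ← (hc.mul_left _).tsum_add (he.mul_left _)]
    refine tsum_congr fun k => ?_
    have h1 := (hx0 k).ne'
    have h2 := (hz0 k).ne'
    field_simp
    ring
  · rw [neg_mul, abs_neg, abs_of_nonneg (mul_nonneg (sq_nonneg _) (tsum_nonneg hterm0)),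
      div_eq_mul_one_div, mul_assoc]
    refine mul_le_mul_of_nonneg_left ?_ (sq_nonneg _)
    rw [cn, ← tsum_mul_left]
    exact he.tsum_le_tsum hle (hc.mul_left _)

end
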